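/- Let s be a key local score function (L s = 0 identically) and let φ = q_0 · s be the standard gauge choice, where q_0 · s denotes pointwise multiplication of s by the coordinate q_0. Then the boundary entropy function H_b := C φ vanishes identically. -/

import Mathlib

noncomputable section

/-- The type of candidate local functions: functions of `x` and the jet `(q₀, q₁, …)`. -/
abbrev QFun := ℝ → (ℕ → ℝ) → ℝ

/-- `IsQFunc X m f` : `f` is a q-function of order `m` on `X`: it depends only on
`x, q_0, …, q_m` and is infinitely differentiable for `x ∈ X`, `q_0 > 0`. -/
def IsQFunc (X : Set ℝ) (m : ℕ) (f : QFun) : Prop :=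
  ∃ F : ℝ × (Fin (m + 1) → ℝ) → ℝ,
    ContDiffOn ℝ (⊤ : ℕ∞) F {p : ℝ × (Fin (m + 1) → ℝ) | p.1 ∈ X ∧ 0 < p.2 0} ∧
    ∀ x q, f x q = F (x, fun i => q i.val)

/-- Partial derivative with respect to `x`. -/
def pdx (f : QFun) : QFun := fun x q => deriv (fun t => f t q) x

/-- Partial derivative with respect to `q_j`. -/
def pd (j : ℕ) (f : QFun) : QFun :=
  fun x q => deriv (fun t => f x (Function.update q j t)) (q j)

/-- The total-derivative operator `D f = ∂f/∂x + Σ_j q_{j+1} ∂f/∂q_j`. -/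
def Dop (f : QFun) : QFun :=
  fun x q => pdx f x q + ∑' j : ℕ, q (j + 1) * pd j f x q

/-- The Lagrange operator `Λ f = Σ_k (-1)^k D^k (∂f/∂q_k)`. -/
def Lam (f : QFun) : QFun :=
  fun x q => ∑' k : ℕ, (-1 : ℝ) ^ k * Dop^[k] (pd k f) x q

/-- The operator `L f = Σ_k (-1)^(k+1) D^k (q_0 ∂f/∂q_k)`. -/
def Lop (f : QFun) : QFun :=
  fun x q => ∑' k : ℕ, (-1 : ℝ) ^ (k + 1) * Dop^[k] (fun y p => p 0 * pd k f y p) x q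

/-- The Euler operator `E f = Σ_j q_j ∂f/∂q_j`. -/
def Eop (f : QFun) : QFun := fun x q => ∑' j : ℕ, q j * pd j f x q

/-- The operator `B_r f = Σ_{k ≥ r+1} (-1)^(k-1-r) D^(k-1-r) (∂f/∂q_k)`, for `r ≥ -1`. -/
def Bop (r : ℤ) (f : QFun) : QFun :=
  fun x q => ∑' k : ℕ,
    if r + 1 ≤ (k : ℤ) then
      (-1 : ℝ) ^ ((k : ℤ) - 1 - r).toNat * Dop^[((k : ℤ) - 1 - r).toNat] (pd k f) x q
    else 0

/-- The operator `C f = Σ_{r ≥ 0} q_r B_r f`. -/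
def Cop (f : QFun) : QFun := fun x q => ∑' r : ℕ, q r * Bop (r : ℤ) f x q

/-- `f` is homogeneous of degree `h` in `(q_0, q_1, …)`. -/
def IsHomog (X : Set ℝ) (h : ℝ) (f : QFun) : Prop :=
  ∀ x ∈ X, ∀ q : ℕ → ℝ, 0 < q 0 → ∀ l : ℝ, 0 < l →
    f x (fun j => l * q j) = l ^ h * f x q

/-- `X` is a nonempty open (possibly infinite or semi-infinite) interval of `ℝ`. -/
def IsOpenInterval (X : Set ℝ) : Prop := IsOpen X ∧ X.OrdConnected ∧ X.Nonempty

section VectorFields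

variable {R A ι : Type*} [CommRing R] [CommRing A] [Algebra R A]

/-- The formal vector field `Σ_o b_o ∂_o`; meaningful when only finitely many `∂_o f` are nonzero. -/
def vectorField (d : ι → Derivation R A A) (b : ι → A) (f : A) : A := ∑ᶠ o, b o * d o f

variable {d : ι → Derivation R A A}

lemma vectorField_eq_sum (b : ι → A) {f : A} {S : Finset ι} (hS : ∀ o ∉ S, d o f = 0) :
    vectorField d b f = ∑ o ∈ S, b o * d o f := by
  refine finsum_eq_sum_of_support_subset _ fun o ho => ?_
  by_contra h
  exact ho (by simp [hS o h])

lemma exists_common_support (hfin : ∀ f, {o | d o f ≠ 0}.Finite) (f g : A) :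
    ∃ S : Finset ι, (∀ o ∉ S, d o f = 0) ∧ ∀ o ∉ S, d o g = 0 := by
  classical
  refine ⟨(hfin f).toFinset ∪ (hfin g).toFinset, fun o ho => ?_, fun o ho => ?_⟩ <;>
    by_contra h <;> simp_all

lemma vectorField_add (hfin : ∀ f, {o | d o f ≠ 0}.Finite) (b : ι → A) (f g : A) :
    vectorField d b (f + g) = vectorField d b f + vectorField d b g := by
  obtain ⟨S, hf, hg⟩ := exists_common_support hfin f g
  rw [vectorField_eq_sum b hf, vectorField_eq_sum b hg,
    vectorField_eq_sum b (S := S) fun o ho => by simp [hf o ho, hg o ho],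
    ← Finset.sum_add_distrib]
  simp [mul_add]

lemma vectorField_mul (hfin : ∀ f, {o | d o f ≠ 0}.Finite) (b : ι → A) (f g : A) :
    vectorField d b (f * g) = f * vectorField d b g + g * vectorField d b f := by
  obtain ⟨S, hf, hg⟩ := exists_common_support hfin f g
  rw [vectorField_eq_sum b hf, vectorField_eq_sum b hg,
    vectorField_eq_sum b (S := S) fun o ho => by simp [hf o ho, hg o ho],
    Finset.mul_sum, Finset.mul_sum, ← Finset.sum_add_distrib]
  refine Finset.sum_congr rfl fun o _ => ?_
  simp only [Derivation.leibniz, smul_eq_mul]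
  ring

/-- The vector field with coefficients `b`, as a derivation. -/
def vectorFieldDer (hfin : ∀ f, {o | d o f ≠ 0}.Finite) (b : ι → A) : Derivation R A A :=
  Derivation.mk'
    { toFun := vectorField d b
      map_add' := vectorField_add hfin b
      map_smul' := fun r f => by
        simp only [RingHom.id_apply, Algebra.smul_def]
        rw [vectorField_mul hfin]
        have : vectorField d b (algebraMap R A r) = 0 := by
          rw [vectorField_eq_sum b (S := ∅) (by simp)]; simp
        rw [this]; simp }
    (vectorField_mul hfin b)

lemma vectorFieldDer_eq_sum (hfin : ∀ f, {o | d o f ≠ 0}.Finite) (b : ι → A) {f : A}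
    {S : Finset ι} (hS : ∀ o ∉ S, d o f = 0) :
    vectorFieldDer hfin b f = ∑ o ∈ S, b o * d o f :=
  vectorField_eq_sum b hS

lemma der_vectorFieldDer (hfin : ∀ f, {o | d o f ≠ 0}.Finite)
    (hcomm : ∀ i j f, d i (d j f) = d j (d i f)) (b : ι → A) (i : ι) (f : A) :
    d i (vectorFieldDer hfin b f) =
      vectorFieldDer hfin b (d i f) + vectorField d (fun o => d i (b o)) f := by
  have hS : ∀ o ∉ (hfin f).toFinset, d o f = 0 := fun o ho => by simpa using ho
  rw [vectorFieldDer_eq_sum hfin b hS, vectorField_eq_sum _ hS,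
    vectorFieldDer_eq_sum hfin b (S := (hfin f).toFinset) fun o ho => by
      rw [hcomm, hS o ho, map_zero], map_sum, ← Finset.sum_add_distrib]
  refine Finset.sum_congr rfl fun o _ => ?_
  rw [Derivation.leibniz, smul_eq_mul, smul_eq_mul, hcomm i o]
  ring

end VectorFields

section JetAlgebra

variable {R A : Type*} [CommRing R] [CommRing A] [Algebra R A]
  {d : Option ℕ → Derivation R A A} {q : ℕ → A}

/-- The coefficients of the total derivative. -/
def totalCoeff (q : ℕ → A) (o : Option ℕ) : A := o.elim 1 fun j => q (j + 1)

/-- The coefficients of the Euler field. -/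
def eulerCoeff (q : ℕ → A) (o : Option ℕ) : A := o.elim 0 q

variable (hfin : ∀ f, {o | d o f ≠ 0}.Finite)
  (hcomm : ∀ i j f, d i (d j f) = d j (d i f))
  (hq : ∀ o j, d o (q j) = if o = some j then 1 else 0)

include hq in
lemma vectorFieldDer_coord (b : Option ℕ → A) (j : ℕ) :
    vectorFieldDer hfin b (q j) = b (some j) := by
  rw [vectorFieldDer_eq_sum hfin b (S := {some j}) fun o ho => by
    rw [hq, if_neg (by simpa using ho)]]
  simp [hq]

include hcomm hq in
lemma der_zero_total (f : A) :
    d (some 0) (vectorFieldDer hfin (totalCoeff q) f) =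
      vectorFieldDer hfin (totalCoeff q) (d (some 0) f) := by
  rw [der_vectorFieldDer hfin hcomm, vectorField_eq_sum _ (S := (hfin f).toFinset) (by simp)]
  rw [Finset.sum_eq_zero, add_zero]
  rintro (_ | j) _ <;> simp [totalCoeff, hq]

include hcomm hq in
lemma der_succ_total (k : ℕ) (f : A) :
    d (some (k + 1)) (vectorFieldDer hfin (totalCoeff q) f) =
      vectorFieldDer hfin (totalCoeff q) (d (some (k + 1)) f) + d (some k) f := by
  rw [der_vectorFieldDer hfin hcomm]
  congr 1
  rw [vectorField, finsum_eq_single _ (some k)]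
  · simp [totalCoeff, hq]
  · rintro (_ | j) hj
    · simp [totalCoeff]
    · have : k ≠ j := fun h => hj (by rw [h])
      simp [totalCoeff, hq, this]

include hcomm hq in
lemma euler_der (k : ℕ) (f : A) :
    vectorFieldDer hfin (eulerCoeff q) (d (some k) f) =
      d (some k) (vectorFieldDer hfin (eulerCoeff q) f) - d (some k) f := by
  rw [der_vectorFieldDer hfin hcomm, eq_sub_iff_add_eq]
  congr 1
  rw [vectorField, finsum_eq_single _ (some k)]
  · simp [eulerCoeff, hq]
  · rintro (_ | j) hj
    · simp [eulerCoeff]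
    · have : k ≠ j := fun h => hj (by rw [h])
      simp [eulerCoeff, hq, this]

include hcomm hq in
lemma euler_der_none (f : A) :
    vectorFieldDer hfin (eulerCoeff q) (d none f) =
      d none (vectorFieldDer hfin (eulerCoeff q) f) := by
  rw [der_vectorFieldDer hfin hcomm, left_eq_add,
    vectorField_eq_sum _ (S := (hfin f).toFinset) (by simp)]
  apply Finset.sum_eq_zero
  rintro (_ | j) _ <;> simp [eulerCoeff, hq]

include hcomm hq in
lemma euler_total (f : A) :
    vectorFieldDer hfin (eulerCoeff q) (vectorFieldDer hfin (totalCoeff q) f) =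
      vectorFieldDer hfin (totalCoeff q) (vectorFieldDer hfin (eulerCoeff q) f) := by
  set E := vectorFieldDer hfin (eulerCoeff q) with hE
  obtain ⟨S, hf, hg⟩ := exists_common_support hfin f (E f)
  rw [vectorFieldDer_eq_sum hfin _ hf, vectorFieldDer_eq_sum hfin _ hg, map_sum]
  refine Finset.sum_congr rfl fun o _ => ?_
  rw [Derivation.leibniz, smul_eq_mul, smul_eq_mul]
  rcases o with _ | j
  · simp [totalCoeff, hE, euler_der_none hfin hcomm hq]
  · simp only [totalCoeff, Option.elim, hE, euler_der hfin hcomm hq,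
      vectorFieldDer_coord hfin hq, eulerCoeff]
    ring

end JetAlgebra

section Boundary

variable {R A : Type*} [CommRing R] [CommRing A] [Algebra R A]

/-- The alternating sum `Σ_{i < N} (-D)^i ∂_{n+i} f`. -/
def altSum (D : Derivation R A A) (p : ℕ → Derivation R A A) (N n : ℕ) (f : A) : A :=
  ∑ i ∈ Finset.range N, (-1 : ℤ) ^ i • D^[i] (p (n + i) f)

variable {D E : Derivation R A A} {p : ℕ → Derivation R A A} {q : ℕ → A}

lemma altSum_eq_of_le {N K n : ℕ} (h : N ≤ K) {f : A} (hf : ∀ k ≥ n + N, p k f = 0) :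
    altSum D p K n f = altSum D p N n f := by
  refine (Finset.sum_subset (Finset.range_mono h) fun i _ hi => ?_).symm
  rw [hf _ (by simp at hi; omega), iterate_map_zero, smul_zero]

lemma altSum_add (N n : ℕ) (f g : A) :
    altSum D p N n (f + g) = altSum D p N n f + altSum D p N n g := by
  simp [altSum, ← Finset.sum_add_distrib, iterate_map_add]

lemma altSum_zero_of_bound {N n : ℕ} {f : A} (hf : ∀ k ≥ n, p k f = 0) :
    altSum D p N n f = 0 :=
  Finset.sum_eq_zero fun i _ => by rw [hf _ (by omega), iterate_map_zero, smul_zero]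

lemma total_altSum_succ {N n : ℕ} {f : A} (hf : ∀ k ≥ N, p k f = 0) :
    D (altSum D p N (n + 1) f) = p n f - altSum D p N n f := by
  rw [← altSum_eq_of_le (n := n) (K := N + 1) (by omega) fun k hk => hf k (by omega)]
  simp only [altSum]
  rw [Finset.sum_range_succ', map_sum]
  simp only [pow_zero, one_smul, Function.iterate_zero, id_eq, add_zero, sub_add_cancel_right,
    ← Finset.sum_neg_distrib]
  refine Finset.sum_congr rfl fun i _ => ?_
  rw [map_zsmul, Function.iterate_succ_apply', pow_succ, show n + 1 + i = n + (i + 1) by ring]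
  simp

lemma altSum_total (h0 : ∀ f, p 0 (D f) = D (p 0 f))
    (hsucc : ∀ k f, p (k + 1) (D f) = D (p (k + 1) f) + p k f) (K : ℕ) (g : A) :
    altSum D p (K + 1) 0 (D g) = (-1 : ℤ) ^ K • D^[K + 1] (p K g) := by
  induction K with
  | zero => simp [altSum, h0]
  | succ K ih =>
    rw [altSum, Finset.sum_range_succ, ← altSum, ih, zero_add, hsucc, iterate_map_add,
      ← Function.iterate_succ_apply, smul_add, pow_succ]
    simp

lemma euler_altSum (hED : ∀ f, E (D f) = D (E f)) (hEp : ∀ k f, E (p k f) = p k (E f) - p k f)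
    (N n : ℕ) (f : A) :
    E (altSum D p N n f) = altSum D p N n (E f) - altSum D p N n f := by
  simp only [altSum, map_sum, map_zsmul, ← Finset.sum_sub_distrib, ← smul_sub]
  refine Finset.sum_congr rfl fun i _ => ?_
  have h : Function.Commute (E : A → A) D^[i] := Function.Commute.iterate_right hED i
  rw [h.eq, hEp, iterate_map_sub]

/-- If `Λ (q₀ s) = s` then `Σ_r q_r B_r (q₀ s) = 0`. -/
theorem boundary_eq_zero (h0 : ∀ f, p 0 (D f) = D (p 0 f))
    (hsucc : ∀ k f, p (k + 1) (D f) = D (p (k + 1) f) + p k f)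
    (hED : ∀ f, E (D f) = D (E f)) (hEp : ∀ k f, E (p k f) = p k (E f) - p k f)
    (hDq : ∀ j, D (q j) = q (j + 1)) (hEq : ∀ j, E (q j) = q j)
    (hE : ∀ f N, (∀ k ≥ N, p k f = 0) → E f = ∑ j ∈ Finset.range N, q j * p j f)
    (hbd : ∀ f, ∃ N, ∀ k ≥ N, p k f = 0)
    {s : A} {N : ℕ} (hN : ∀ k ≥ N, p k (q 0 * s) = 0)
    (hs : altSum D p N 0 (q 0 * s) = s) :
    ∑ r ∈ Finset.range N, q r * altSum D p N (r + 1) (q 0 * s) = 0 := by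
  set φ := q 0 * s with hφ
  set C := ∑ r ∈ Finset.range N, q r * altSum D p N (r + 1) φ with hC
  have hEφ : E φ = φ + q 0 * E s := by
    rw [hφ, Derivation.leibniz, hEq, smul_eq_mul, smul_eq_mul]; ring
  have hDC : D C = q 0 * E s := by
    have key : ∀ r, D (q r * altSum D p N (r + 1) φ) =
        q r * p r φ + (q (r + 1) * altSum D p N (r + 1) φ - q r * altSum D p N r φ) := fun r => by
      rw [Derivation.leibniz, total_altSum_succ hN, hDq, smul_eq_mul, smul_eq_mul]; ring
    rw [hC, map_sum, Finset.sum_congr rfl fun r _ => key r, Finset.sum_add_distrib, ← hE φ N hN,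
      Finset.sum_range_sub (fun r => q r * altSum D p N r φ), altSum_zero_of_bound hN, hs, hEφ]
    ring
  obtain ⟨M, hM⟩ := hbd C
  have hEs : E s = 0 := by
    have hK : altSum D p (N + M + 1) 0 φ = s := by
      rw [altSum_eq_of_le (N := N) (by omega) fun k hk => hN k (by omega), hs]
    have h1 := euler_altSum hED hEp (N + M + 1) 0 φ
    rw [hEφ, ← hDC, altSum_add, altSum_total h0 hsucc, hM _ (by omega), iterate_map_zero, hK] at h1
    simpa using h1
  have hDC0 : D C = 0 := by rw [hDC, hEs, mul_zero]
  have hpC : ∀ k, p k C = 0 := by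
    intro k
    have h : ∀ i k, M ≤ k + i → p k C = 0 := by
      intro i
      induction i with
      | zero => exact fun k hk => hM k hk
      | succ i ih =>
        intro k hk
        have h2 := hsucc k C
        rw [hDC0, ih (k + 1) (by omega)] at h2
        simpa using h2.symm
    exact h M k (by omega)
  have hEC0 : E C = 0 := by rw [hE C 0 fun k _ => hpC k]; simp
  have hEC : E C = C := by
    rw [hC, map_sum]
    refine Finset.sum_congr rfl fun r _ => ?_
    rw [Derivation.leibniz, euler_altSum hED hEp, hEφ, hEs, mul_zero, add_zero, sub_self, hEq]
    simp [mul_comm]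
  rw [← hEC, hEC0]

end Boundary

section Concrete

/-- The phase space: points `(x, q)` with `x ∈ X` and `q₀ > 0`. -/
def jetDomain (X : Set ℝ) : Set (ℝ × (ℕ → ℝ)) := {p | p.1 ∈ X ∧ 0 < p.2 0}

/-- The truncation of the phase space to jets of order `m`. -/
def truncDomain (X : Set ℝ) (m : ℕ) : Set (ℝ × (Fin (m + 1) → ℝ)) := {p | p.1 ∈ X ∧ 0 < p.2 0}

/-- Forgetting the coordinates `q_j` with `j > m`. -/
def trunc (m : ℕ) (p : ℝ × (ℕ → ℝ)) : ℝ × (Fin (m + 1) → ℝ) := (p.1, fun i => p.2 i)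

lemma isOpen_truncDomain {X : Set ℝ} (hX : IsOpen X) (m : ℕ) : IsOpen (truncDomain X m) :=
  (hX.preimage continuous_fst).inter
    (isOpen_lt continuous_const ((continuous_apply 0).comp continuous_snd))

lemma trunc_mem {X : Set ℝ} {m : ℕ} {p : ℝ × (ℕ → ℝ)} :
    trunc m p ∈ truncDomain X m ↔ p ∈ jetDomain X := Iff.rfl

/-- `F` is a smooth representative, of order `m`, of the function `f` on the phase space. -/
def IsRep {X : Set ℝ} (f : jetDomain X → ℝ) (m : ℕ) (F : ℝ × (Fin (m + 1) → ℝ) → ℝ) : Prop :=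
  ContDiffOn ℝ (⊤ : ℕ∞) F (truncDomain X m) ∧ ∀ p, f p = F (trunc m p)

lemma IsRep.exists_of_le {X : Set ℝ} {f : jetDomain X → ℝ} {m : ℕ}
    {F : ℝ × (Fin (m + 1) → ℝ) → ℝ} (h : IsRep f m F) {n : ℕ} (hmn : m ≤ n) :
    ∃ G, IsRep f n G := by
  refine ⟨fun z => F (z.1, fun i => z.2 (Fin.castLE (by omega) i)), ?_, h.2⟩
  refine h.1.comp (ContDiff.contDiffOn (by fun_prop)) fun z hz => ⟨hz.1, ?_⟩
  exact hz.2

/-- The algebra of q-functions on the phase space. -/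
def qAlg (X : Set ℝ) : Subalgebra ℝ (jetDomain X → ℝ) where
  carrier := {f | ∃ m F, IsRep f m F}
  mul_mem' := by
    rintro f g ⟨m, F, hF⟩ ⟨n, G, hG⟩
    obtain ⟨F', hF'⟩ := hF.exists_of_le (le_max_left m n)
    obtain ⟨G', hG'⟩ := hG.exists_of_le (le_max_right m n)
    exact ⟨_, fun z => F' z * G' z, hF'.1.mul hG'.1, fun p => by
      rw [Pi.mul_apply, hF'.2, hG'.2]⟩
  add_mem' := by
    rintro f g ⟨m, F, hF⟩ ⟨n, G, hG⟩
    obtain ⟨F', hF'⟩ := hF.exists_of_le (le_max_left m n)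
    obtain ⟨G', hG'⟩ := hG.exists_of_le (le_max_right m n)
    exact ⟨_, fun z => F' z + G' z, hF'.1.add hG'.1, fun p => by
      rw [Pi.add_apply, hF'.2, hG'.2]⟩
  algebraMap_mem' r := ⟨0, fun _ => r, contDiffOn_const, fun _ => rfl⟩

/-- The coordinate line through `p` in the direction of `x` (`none`) or of `q_j` (`some j`). -/
def coordLine (o : Option ℕ) (p : ℝ × (ℕ → ℝ)) (t : ℝ) : ℝ × (ℕ → ℝ) :=
  o.elim (t, p.2) fun j => (p.1, Function.update p.2 j t)

/-- The value of the coordinate `x` (`none`) or `q_j` (`some j`) at `p`. -/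
def coordVal (o : Option ℕ) (p : ℝ × (ℕ → ℝ)) : ℝ := o.elim p.1 p.2

/-- The truncated coordinate direction. -/
def coordDir (o : Option ℕ) (m : ℕ) : ℝ × (Fin (m + 1) → ℝ) :=
  o.elim (1, 0) fun j => (0, fun i => if (i : ℕ) = j then 1 else 0)

/-- The partial derivative of a function on the whole space of pairs `(x, q)`. -/
def pderiv (o : Option ℕ) (f : ℝ × (ℕ → ℝ) → ℝ) (p : ℝ × (ℕ → ℝ)) : ℝ :=
  deriv (fun t => f (coordLine o p t)) (coordVal o p)

lemma coordLine_coordVal (o : Option ℕ) (p : ℝ × (ℕ → ℝ)) :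
    coordLine o p (coordVal o p) = p := by
  cases o <;> simp [coordLine, coordVal]

lemma hasDerivAt_trunc_coordLine (o : Option ℕ) (m : ℕ) (p : ℝ × (ℕ → ℝ)) (t : ℝ) :
    HasDerivAt (fun t => trunc m (coordLine o p t)) (coordDir o m) t := by
  cases o with
  | none => exact (hasDerivAt_id t).prodMk (hasDerivAt_const t fun i : Fin (m + 1) => p.2 i)
  | some j =>
    refine (hasDerivAt_const t _).prodMk (hasDerivAt_pi.2 fun i => ?_)
    by_cases h : (i : ℕ) = j
    · simpa [trunc, coordLine, h] using hasDerivAt_id' t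
    · simpa [trunc, coordLine, h] using hasDerivAt_const t (p.2 i)

variable {X : Set ℝ}

/-- `f` agrees with `a` on the phase space. -/
def Extends (f : ℝ × (ℕ → ℝ) → ℝ) (a : jetDomain X → ℝ) : Prop := ∀ p : jetDomain X, f p = a p

lemma IsRep.hasDerivAt (hX : IsOpen X) {f : ℝ × (ℕ → ℝ) → ℝ} {a : jetDomain X → ℝ}
    (hf : Extends f a) {m : ℕ} {F : ℝ × (Fin (m + 1) → ℝ) → ℝ} (hF : IsRep a m F)
    (o : Option ℕ) (p : jetDomain X) :
    HasDerivAt (fun t => f (coordLine o p t)) (fderiv ℝ F (trunc m p) (coordDir o m))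
      (coordVal o p) := by
  have hU := isOpen_truncDomain hX m
  have hc := hasDerivAt_trunc_coordLine o m p (coordVal o p)
  have hFd : DifferentiableAt ℝ F (trunc m (coordLine o p (coordVal o p))) := by
    rw [coordLine_coordVal]
    exact (hF.1.differentiableOn (by simp)).differentiableAt (hU.mem_nhds (trunc_mem.2 p.2))
  have h := hFd.hasFDerivAt.comp_hasDerivAt _ hc
  rw [coordLine_coordVal] at h
  refine h.congr_of_eventuallyEq ?_
  have hmem : ∀ᶠ t in nhds (coordVal o (p : ℝ × (ℕ → ℝ))),
      trunc m (coordLine o p t) ∈ truncDomain X m := by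
    refine hc.continuousAt.eventually (hU.mem_nhds ?_)
    beta_reduce
    rw [coordLine_coordVal]
    exact p.2
  filter_upwards [hmem] with t ht
  rw [hf ⟨_, trunc_mem.1 ht⟩, hF.2]
  rfl

lemma IsRep.pderiv_eq (hX : IsOpen X) {f : ℝ × (ℕ → ℝ) → ℝ} {a : jetDomain X → ℝ}
    (hf : Extends f a) {m : ℕ} {F : ℝ × (Fin (m + 1) → ℝ) → ℝ} (hF : IsRep a m F)
    (o : Option ℕ) (p : jetDomain X) :
    pderiv o f p = fderiv ℝ F (trunc m p) (coordDir o m) :=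
  (hF.hasDerivAt hX hf o p).deriv

lemma extends_extend (a : jetDomain X → ℝ) : Extends (Function.extend Subtype.val a 0) a :=
  Subtype.val_injective.extend_apply a 0

lemma IsRep.pderiv (hX : IsOpen X) {f : ℝ × (ℕ → ℝ) → ℝ} {a : jetDomain X → ℝ}
    (hf : Extends f a) {m : ℕ} {F : ℝ × (Fin (m + 1) → ℝ) → ℝ} (hF : IsRep a m F) (o : Option ℕ) :
    IsRep (fun p : jetDomain X => pderiv o f p) m
      (fun z => fderiv ℝ F z (coordDir o m)) :=
  ⟨(hF.1.fderiv_of_isOpen (isOpen_truncDomain hX m) (by simp)).clm_apply contDiffOn_const,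
    hF.pderiv_eq hX hf o⟩

/-- The partial derivative as a function on the algebra of q-functions. -/
def qPartialFun (hX : IsOpen X) (o : Option ℕ) (a : qAlg X) : qAlg X :=
  ⟨fun p => pderiv o (Function.extend Subtype.val a.1 0) p, by
    obtain ⟨m, F, hF⟩ := a.2
    exact ⟨m, _, hF.pderiv hX (extends_extend a.1) o⟩⟩

lemma qPartialFun_eq_of_extends (hX : IsOpen X) (o : Option ℕ) {f : ℝ × (ℕ → ℝ) → ℝ} {a : qAlg X}
    (hf : Extends f a.1) (p : jetDomain X) : (qPartialFun hX o a).1 p = pderiv o f p := by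
  obtain ⟨m, F, hF⟩ := a.2
  rw [hF.pderiv_eq hX hf]
  exact hF.pderiv_eq hX (extends_extend a.1) o p

lemma hasDerivAt_of_extends (hX : IsOpen X) (o : Option ℕ) {f : ℝ × (ℕ → ℝ) → ℝ} {a : qAlg X}
    (hf : Extends f a.1) (p : jetDomain X) :
    HasDerivAt (fun t => f (coordLine o p t)) ((qPartialFun hX o a).1 p) (coordVal o p) := by
  obtain ⟨m, F, hF⟩ := a.2
  rw [qPartialFun_eq_of_extends hX o hf, hF.pderiv_eq hX hf]
  exact hF.hasDerivAt hX hf o p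

/-- The partial derivative as a derivation of the algebra of q-functions. -/
def qPartial (hX : IsOpen X) (o : Option ℕ) : Derivation ℝ (qAlg X) (qAlg X) :=
  Derivation.mk'
    { toFun := qPartialFun hX o
      map_add' := fun a b => by
        ext p
        have ha := extends_extend a.1
        have hb := extends_extend b.1
        have h : Extends (fun z => Function.extend Subtype.val a.1 0 z +
            Function.extend Subtype.val b.1 0 z) (a + b).1 := fun p => congrArg₂ (· + ·) (ha p) (hb p)
        exact (hasDerivAt_of_extends hX o h p).unique
          ((hasDerivAt_of_extends hX o ha p).add (hasDerivAt_of_extends hX o hb p))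
      map_smul' := fun r a => by
        ext p
        have ha := extends_extend a.1
        have h : Extends (fun z => r * Function.extend Subtype.val a.1 0 z) (r • a).1 :=
          fun p => congrArg (r * ·) (ha p)
        exact (hasDerivAt_of_extends hX o h p).unique
          ((hasDerivAt_of_extends hX o ha p).const_mul r) }
    fun a b => by
      ext p
      have ha := extends_extend a.1
      have hb := extends_extend b.1
      have h : Extends (fun z => Function.extend Subtype.val a.1 0 z *
          Function.extend Subtype.val b.1 0 z) (a * b).1 := fun p => congrArg₂ (· * ·) (ha p) (hb p)
      refine (hasDerivAt_of_extends hX o h p).unique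
        (((hasDerivAt_of_extends hX o ha p).mul (hasDerivAt_of_extends hX o hb p)).congr_deriv ?_)
      rw [coordLine_coordVal, ha p, hb p]
      change _ = a.1 p * (qPartialFun hX o b).1 p + b.1 p * (qPartialFun hX o a).1 p
      ring

lemma qPartial_apply (hX : IsOpen X) (o : Option ℕ) {f : ℝ × (ℕ → ℝ) → ℝ} {a : qAlg X}
    (hf : Extends f a.1) (p : jetDomain X) : (qPartial hX o a).1 p = pderiv o f p :=
  qPartialFun_eq_of_extends hX o hf p

lemma IsRep.qPartial (hX : IsOpen X) {a : qAlg X} {m : ℕ} {F : ℝ × (Fin (m + 1) → ℝ) → ℝ}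
    (hF : IsRep a.1 m F) (o : Option ℕ) :
    IsRep (qPartial hX o a).1 m (fun z => fderiv ℝ F z (coordDir o m)) :=
  hF.pderiv hX (extends_extend a.1) o

lemma qPartial_comm (hX : IsOpen X) (i j : Option ℕ) (a : qAlg X) :
    qPartial hX i (qPartial hX j a) = qPartial hX j (qPartial hX i a) := by
  obtain ⟨m, F, hF⟩ := a.2
  ext p
  have hU := isOpen_truncDomain hX m
  have hz : truncDomain X m ∈ nhds (trunc m p) := hU.mem_nhds (trunc_mem.2 p.2)
  have hd : DifferentiableAt ℝ (fderiv ℝ F) (trunc m p) :=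
    ((hF.1.fderiv_of_isOpen (m := 1) hU (by norm_cast)).differentiableOn
      (by simp)).differentiableAt hz
  have key : ∀ i j, (qPartial hX i (qPartial hX j a)).1 p =
      fderiv ℝ (fderiv ℝ F) (trunc m p) (coordDir i m) (coordDir j m) := fun i j => by
    rw [((hF.qPartial hX j).qPartial hX i).2 p]
    beta_reduce
    rw [fderiv_clm_apply hd (by fun_prop)]
    simp
  rw [key, key]
  exact (hF.1.contDiffAt hz).isSymmSndFDerivAt (by simp; exact WithTop.coe_le_coe.2 le_top) _ _

lemma exists_bound_qPartial (hX : IsOpen X) (a : qAlg X) :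
    ∃ N, ∀ k ≥ N, qPartial hX (some k) a = 0 := by
  obtain ⟨m, F, hF⟩ := a.2
  refine ⟨m + 1, fun k hk => ?_⟩
  ext p
  have h : coordDir (some k) m = 0 := by
    ext i
    · rfl
    · have : (i : ℕ) ≠ k := by omega
      simp [coordDir, this]
  rw [(hF.qPartial hX _).2 p, h]
  exact map_zero _

lemma finite_support_qPartial (hX : IsOpen X) (a : qAlg X) :
    {o | qPartial hX o a ≠ 0}.Finite := by
  obtain ⟨N, hN⟩ := exists_bound_qPartial hX a
  refine (Finset.finite_toSet (insert none ((Finset.range N).image some))).subset fun o ho => ?_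
  rcases o with _ | k
  · simp
  · have : k < N := by
      by_contra h
      exact ho (hN k (by omega))
    simpa using this

/-- The coordinate `q_j` as an element of the algebra of q-functions. -/
def qCoord (X : Set ℝ) (j : ℕ) : qAlg X :=
  ⟨fun p => p.1.2 j, j, fun z => z.2 (Fin.last j),
    ContDiff.contDiffOn (by fun_prop), fun _ => rfl⟩

lemma qPartial_qCoord (hX : IsOpen X) (o : Option ℕ) (j : ℕ) :
    qPartial hX o (qCoord X j) = if o = some j then 1 else 0 := by
  ext p
  rw [qPartial_apply hX o (f := fun z => z.2 j) (fun _ => rfl)]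
  rcases o with _ | k
  · simp [pderiv, coordLine]
  · by_cases h : k = j
    · subst h; simp [pderiv, coordLine]
    · have h' : j ≠ k := fun e => h e.symm
      simp [pderiv, coordLine, h, h']

/-- The total derivative on the algebra of q-functions. -/
def qTotal (hX : IsOpen X) : Derivation ℝ (qAlg X) (qAlg X) :=
  vectorFieldDer (finite_support_qPartial hX) (totalCoeff (qCoord X))

lemma sum_insert_none {M : Type*} [AddCommMonoid M] (N : ℕ) (g : Option ℕ → M) :
    ∑ o ∈ insert none ((Finset.range N).image some), g o =
      g none + ∑ j ∈ Finset.range N, g (some j) := by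
  rw [Finset.sum_insert (by simp), Finset.sum_image (by simp)]

lemma vectorFieldDer_eq_range (hX : IsOpen X) (b : Option ℕ → qAlg X) {a : qAlg X} {N : ℕ}
    (hN : ∀ k ≥ N, qPartial hX (some k) a = 0) :
    vectorFieldDer (finite_support_qPartial hX) b a = b none * qPartial hX none a +
      ∑ j ∈ Finset.range N, b (some j) * qPartial hX (some j) a := by
  rw [vectorFieldDer_eq_sum _ b (S := insert none ((Finset.range N).image some)),
    sum_insert_none]
  rintro (_ | k) hk
  · simp at hk
  · exact hN k (by simpa using hk)

/-- The local function `f` restricts to the element `a` of the algebra of q-functions. -/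
def RestrictsTo (f : QFun) (a : qAlg X) : Prop := Extends (fun z => f z.1 z.2) a.1

lemma RestrictsTo.pd (hX : IsOpen X) {f : QFun} {a : qAlg X} (h : RestrictsTo f a) (j : ℕ) :
    RestrictsTo (pd j f) (qPartial hX (some j) a) :=
  fun p => (qPartial_apply hX (some j) h p).symm

lemma RestrictsTo.pdx (hX : IsOpen X) {f : QFun} {a : qAlg X} (h : RestrictsTo f a) :
    RestrictsTo (pdx f) (qPartial hX none a) :=
  fun p => (qPartial_apply hX none h p).symm

lemma RestrictsTo.qCoord_mul {f : QFun} {a : qAlg X} (h : RestrictsTo f a) (j : ℕ) :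
    RestrictsTo (fun y p => p j * f y p) (qCoord X j * a) :=
  fun p => congrArg (p.1.2 j * ·) (h p)

lemma coe_sum_apply {ι : Type*} (S : Finset ι) (g : ι → qAlg X) (p : jetDomain X) :
    (∑ i ∈ S, g i).1 p = ∑ i ∈ S, (g i).1 p := by
  simp

lemma RestrictsTo.Dop (hX : IsOpen X) {f : QFun} {a : qAlg X} (h : RestrictsTo f a) :
    RestrictsTo (Dop f) (qTotal hX a) := by
  intro p
  obtain ⟨N, hN⟩ := exists_bound_qPartial hX a
  rw [qTotal, vectorFieldDer_eq_range hX _ hN]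
  change _ + _ = (totalCoeff (qCoord X) none * qPartial hX none a).1 p + (∑ j ∈ Finset.range N, totalCoeff (qCoord X) (some j) * qPartial hX (some j) a).1 p
  rw [coe_sum_apply, tsum_eq_sum (s := Finset.range N) fun j hj => ?_]
  · congr 1
    · refine (h.pdx hX p).trans ?_
      simp [totalCoeff]
    · exact Finset.sum_congr rfl fun j _ => congrArg (p.1.2 (j + 1) * ·) (h.pd hX j p)
  · have : _root_.pd j f p.1.1 p.1.2 = 0 := by
      refine (h.pd hX j p).trans ?_
      rw [hN j (by simpa using hj)]
      rfl
    rw [this, mul_zero]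

lemma RestrictsTo.iterate_Dop (hX : IsOpen X) {f : QFun} {a : qAlg X} (h : RestrictsTo f a)
    (k : ℕ) : RestrictsTo (_root_.Dop^[k] f) ((qTotal hX)^[k] a) := by
  induction k with
  | zero => exact h
  | succ k ih =>
    rw [Function.iterate_succ_apply', Function.iterate_succ_apply']
    exact ih.Dop hX

lemma coe_sign_smul (k : ℕ) (a : qAlg X) (p : jetDomain X) :
    ((-1 : ℤ) ^ k • a).1 p = (-1 : ℝ) ^ k * a.1 p := by
  rcases Nat.even_or_odd k with h | h <;> simp [h.neg_one_pow]

lemma RestrictsTo.Bop (hX : IsOpen X) {f : QFun} {a : qAlg X} (h : RestrictsTo f a) {N : ℕ}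
    (hN : ∀ k ≥ N, qPartial hX (some k) a = 0) (r : ℕ) :
    RestrictsTo (Bop r f) (altSum (qTotal hX) (fun k => qPartial hX (some k)) N (r + 1) a) := by
  intro p
  rw [altSum, coe_sum_apply]
  have hterm : ∀ i, ((-1 : ℤ) ^ i • (qTotal hX)^[i] (qPartial hX (some (r + 1 + i)) a)).1 p =
      (-1 : ℝ) ^ i * _root_.Dop^[i] (_root_.pd (r + 1 + i) f) p.1.1 p.1.2 := fun i => by
    rw [coe_sign_smul, ← (h.pd hX (r + 1 + i)).iterate_Dop hX i p]
  have hinj : Function.Injective fun i : ℕ => r + 1 + i := add_right_injective _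
  change ∑' k : ℕ, _ = _
  rw [← hinj.tsum_eq, tsum_eq_sum (s := Finset.range N)]
  · refine Finset.sum_congr rfl fun i _ => ?_
    have e : (((r + 1 + i : ℕ) : ℤ) - 1 - r).toNat = i := by omega
    rw [hterm, e, if_pos (by omega)]
  · intro i hi
    have e : (((r + 1 + i : ℕ) : ℤ) - 1 - r).toNat = i := by omega
    rw [e, if_pos (by omega), ← hterm, hN _ (by simp at hi; omega), iterate_map_zero, smul_zero]
    rfl
  · intro k hk
    have hk' : (r : ℤ) + 1 ≤ k := by
      by_contra hlt
      exact hk (if_neg hlt)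
    exact ⟨k - (r + 1), by dsimp only; omega⟩

lemma RestrictsTo.Cop (hX : IsOpen X) {f : QFun} {a : qAlg X} (h : RestrictsTo f a) {N : ℕ}
    (hN : ∀ k ≥ N, qPartial hX (some k) a = 0) :
    RestrictsTo (Cop f) (∑ r ∈ Finset.range N, qCoord X r *
      altSum (qTotal hX) (fun k => qPartial hX (some k)) N (r + 1) a) := by
  intro p
  rw [coe_sum_apply]
  change ∑' r : ℕ, _ = _
  rw [tsum_eq_sum (s := Finset.range N) fun r hr => ?_]
  · exact Finset.sum_congr rfl fun r _ => congrArg (p.1.2 r * ·) (h.Bop hX hN r p)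
  · have : _root_.Bop r f p.1.1 p.1.2 = 0 := by
      refine (h.Bop hX hN r p).trans ?_
      rw [altSum_zero_of_bound fun k hk => hN k (by simp at hr; omega)]
      rfl
    rw [this, mul_zero]

lemma RestrictsTo.Lop (hX : IsOpen X) {f : QFun} {a : qAlg X} (h : RestrictsTo f a) {N : ℕ}
    (hN : ∀ k ≥ N, qPartial hX (some k) a = 0) :
    RestrictsTo (Lop f) (-∑ k ∈ Finset.range N,
      (-1 : ℤ) ^ k • (qTotal hX)^[k] (qCoord X 0 * qPartial hX (some k) a)) := by
  intro p
  change ∑' k : ℕ, _ = -(∑ k ∈ Finset.range N,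
    (-1 : ℤ) ^ k • (qTotal hX)^[k] (qCoord X 0 * qPartial hX (some k) a)).1 p
  rw [coe_sum_apply, ← Finset.sum_neg_distrib]
  have hD : ∀ k, _root_.Dop^[k] (fun y p => p 0 * _root_.pd k f y p) p.1.1 p.1.2 = _ := fun k =>
    ((h.pd hX k).qCoord_mul 0).iterate_Dop hX k p
  rw [tsum_eq_sum (s := Finset.range N)]
  · refine Finset.sum_congr rfl fun k _ => ?_
    rw [hD, coe_sign_smul, pow_succ]
    ring
  · intro k hk
    rw [hD, hN k (by simpa using hk), mul_zero, iterate_map_zero]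
    exact mul_zero _

lemma altSum_qCoord_mul (hX : IsOpen X) {a : qAlg X} {N : ℕ} (hN0 : 0 < N) :
    altSum (qTotal hX) (fun k => qPartial hX (some k)) N 0 (qCoord X 0 * a) = a +
      ∑ k ∈ Finset.range N,
        (-1 : ℤ) ^ k • (qTotal hX)^[k] (qCoord X 0 * qPartial hX (some k) a) := by
  obtain ⟨N, rfl⟩ : ∃ n, N = n + 1 := ⟨N - 1, by omega⟩
  simp only [altSum, zero_add, Finset.sum_range_succ', Derivation.leibniz, qPartial_qCoord]
  simp
  ring

end Concrete

/-- Let `s` be a key local score function (`L s = 0` identically)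
and let `φ = q₀ ⬝ s` be the standard gauge choice. Then the boundary entropy
function `H_b = C φ` vanishes identically. -/
theorem stmt16 (X : Set ℝ) (hX : IsOpenInterval X) (m : ℕ) (s : QFun)
    (hs : IsQFunc X m s)
    (hL : ∀ x ∈ X, ∀ q : ℕ → ℝ, 0 < q 0 → Lop s x q = 0) :
    ∀ x ∈ X, ∀ q : ℕ → ℝ, 0 < q 0 → Cop (fun y p => p 0 * s y p) x q = 0 := by
  have hXo := hX.1
  obtain ⟨F, hF, hFs⟩ := hs
  let a : qAlg X := ⟨fun p => s p.1.1 p.1.2, m, F, hF, fun p => hFs _ _⟩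
  have ha : RestrictsTo s a := fun _ => rfl
  obtain ⟨N₀, hN₀⟩ := exists_bound_qPartial hXo a
  have hN : ∀ k ≥ N₀ + 1, qPartial hXo (some k) a = 0 := fun k hk => hN₀ k (by omega)
  have hφ : ∀ k ≥ N₀ + 1, qPartial hXo (some k) (qCoord X 0 * a) = 0 := fun k hk => by
    have hk0 : k ≠ 0 := by omega
    rw [Derivation.leibniz, hN k hk, qPartial_qCoord]
    simp [hk0]
  have hLa : ∑ k ∈ Finset.range (N₀ + 1),
      (-1 : ℤ) ^ k • (qTotal hXo)^[k] (qCoord X 0 * qPartial hXo (some k) a) = 0 := by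
    rw [← neg_eq_zero]
    ext p
    exact (ha.Lop hXo hN p).symm.trans (hL _ p.2.1 _ p.2.2)
  have hfin := finite_support_qPartial hXo
  have hcomm := qPartial_comm hXo
  have hq := qPartial_qCoord hXo
  have key := boundary_eq_zero (D := qTotal hXo)
    (E := vectorFieldDer hfin (eulerCoeff (qCoord X)))
    (p := fun k => qPartial hXo (some k)) (q := qCoord X)
    (der_zero_total hfin hcomm hq) (der_succ_total hfin hcomm hq) (euler_total hfin hcomm hq)
    (euler_der hfin hcomm hq) (vectorFieldDer_coord hfin hq _) (vectorFieldDer_coord hfin hq _)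
    (fun f N hf => by rw [vectorFieldDer_eq_range hXo _ hf]; simp [eulerCoeff])
    (exists_bound_qPartial hXo) hφ
    (by rw [altSum_qCoord_mul hXo (Nat.succ_pos N₀), hLa, add_zero])
  intro x hx q hq0
  have h := (ha.qCoord_mul 0).Cop hXo hφ ⟨(x, q), hx, hq0⟩
  rw [key] at h
  exact h

end
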